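/- Let Z_1, Z_2 ∈ ℝ³ with Z_1 ≠ Z_2 and d_1 ≥ d_2 ≥ 0, and let X be the set of global minimizers of the distance-error objective O(W) = |‖W − Z_1‖ − d_1| + |‖W − Z_2‖ − d_2| on ℝ³. Then X has exactly one element if and only if ‖Z_2 − Z_1‖ = d_1 + d_2 or ‖Z_2 − Z_1‖ = d_1 − d_2; otherwise X is infinite. -/

import Mathlib

section

open scoped InnerProductSpace

variable {E : Type*} [NormedAddCommGroup E] [InnerProductSpace ℝ E]

/-- A point of the line through `Z₁` and `Z₂`, given by its signed distance from `Z₁`. -/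
lemma norm_lineMap_sub_left {Z₁ Z₂ : E} (hZ : Z₁ ≠ Z₂) {t : ℝ} (ht : 0 ≤ t) :
    ‖AffineMap.lineMap Z₁ Z₂ (t / ‖Z₂ - Z₁‖) - Z₁‖ = t := by
  have hD : 0 < ‖Z₂ - Z₁‖ := norm_pos_iff.2 (sub_ne_zero.2 hZ.symm)
  rw [AffineMap.lineMap_apply_module', add_sub_cancel_right, norm_smul, Real.norm_eq_abs,
    abs_of_nonneg (by positivity)]
  field_simp

lemma norm_lineMap_sub_right {Z₁ Z₂ : E} (hZ : Z₁ ≠ Z₂) (t : ℝ) :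
    ‖AffineMap.lineMap Z₁ Z₂ (t / ‖Z₂ - Z₁‖) - Z₂‖ = |t - ‖Z₂ - Z₁‖| := by
  have hD : 0 < ‖Z₂ - Z₁‖ := norm_pos_iff.2 (sub_ne_zero.2 hZ.symm)
  have h : AffineMap.lineMap Z₁ Z₂ (t / ‖Z₂ - Z₁‖) - Z₂ =
      ((t - ‖Z₂ - Z₁‖) / ‖Z₂ - Z₁‖) • (Z₂ - Z₁) := by
    rw [AffineMap.lineMap_apply_module', sub_div, div_self hD.ne']
    module
  rw [h, norm_smul, Real.norm_eq_abs, abs_div, abs_of_pos hD]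
  field_simp

/-- A set containing a nondegenerate segment of the line through `Z₁` and `Z₂` is infinite. -/
lemma infinite_of_lineMap_mem {Z₁ Z₂ : E} (hZ : Z₁ ≠ Z₂) {a b : ℝ} (hab : a < b) {X : Set E}
    (h : ∀ t ∈ Set.Icc a b, AffineMap.lineMap Z₁ Z₂ (t / ‖Z₂ - Z₁‖) ∈ X) : X.Infinite := by
  have hD : 0 < ‖Z₂ - Z₁‖ := norm_pos_iff.2 (sub_ne_zero.2 hZ.symm)
  refine Set.infinite_of_injOn_mapsTo (f := fun t : ℝ => AffineMap.lineMap Z₁ Z₂ (t / ‖Z₂ - Z₁‖))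
    (fun s _ t _ hst => ?_) h (Set.Icc_infinite hab)
  exact (div_left_inj' hD.ne').1 (AffineMap.lineMap_injective ℝ hZ hst)

/-- Two tangent spheres meet only at the tangency point. -/
lemma eq_lineMap_of_tangent {Z₁ Z₂ W : E} (hZ : Z₁ ≠ Z₂) {d₁ d₂ : ℝ}
    (h : ‖Z₂ - Z₁‖ = d₁ + d₂ ∨ ‖Z₂ - Z₁‖ = d₁ - d₂)
    (h₁ : ‖W - Z₁‖ = d₁) (h₂ : ‖W - Z₂‖ = d₂) :
    W = AffineMap.lineMap Z₁ Z₂ (d₁ / ‖Z₂ - Z₁‖) := by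
  have hD : 0 < ‖Z₂ - Z₁‖ := norm_pos_iff.2 (sub_ne_zero.2 hZ.symm)
  have e₂ := norm_sub_sq_real (W - Z₁) (Z₂ - Z₁)
  rw [sub_sub_sub_cancel_right, h₁, h₂] at e₂
  have hin : ⟪W - Z₁, Z₂ - Z₁⟫_ℝ = d₁ * ‖Z₂ - Z₁‖ := by
    rcases h with h | h <;> rw [h] at e₂ ⊢ <;> linarith
  have e₃ := norm_sub_sq_real (W - Z₁) ((d₁ / ‖Z₂ - Z₁‖) • (Z₂ - Z₁))
  rw [real_inner_smul_right, hin, norm_smul, h₁, mul_pow, Real.norm_eq_abs, sq_abs] at e₃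
  have e₄ : ‖(W - Z₁) - (d₁ / ‖Z₂ - Z₁‖) • (Z₂ - Z₁)‖ ^ 2 = 0 := by
    rw [e₃]; field_simp; ring
  have e₅ := sub_eq_zero.1 (norm_eq_zero.1 (pow_eq_zero_iff two_ne_zero |>.1 e₄))
  rw [AffineMap.lineMap_apply_module', ← e₅, sub_add_cancel]

/-- Two spheres of three-dimensional space crossing transversally have infinitely many common
points. -/
lemma infinite_sphere_inter_sphere (hE : Module.finrank ℝ E = 3) {Z₁ Z₂ : E} (hZ : Z₁ ≠ Z₂)
    {d₁ d₂ : ℝ} (hd₁ : 0 ≤ d₁) (hd₂ : 0 ≤ d₂)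
    (hlow : |d₁ - d₂| < ‖Z₂ - Z₁‖) (hup : ‖Z₂ - Z₁‖ < d₁ + d₂) :
    {W : E | ‖W - Z₁‖ = d₁ ∧ ‖W - Z₂‖ = d₂}.Infinite := by
  have hD : 0 < ‖Z₂ - Z₁‖ := norm_pos_iff.2 (sub_ne_zero.2 hZ.symm)
  have : Fact (Module.finrank ℝ E = 2 + 1) := ⟨hE⟩
  have : FiniteDimensional ℝ E := .of_fact_finrank_eq_succ 2
  set e := Z₂ - Z₁ with he
  set D := ‖e‖ with hDe
  have he0 : e ≠ 0 := norm_pos_iff.1 hD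
  let b := (stdOrthonormalBasis ℝ (ℝ ∙ e)ᗮ).reindex
    (finCongr (Submodule.finrank_orthogonal_span_singleton (𝕜 := ℝ) (n := 2) he0))
  set f : E := (b 0).1 with hf
  set g : E := (b 1).1 with hg
  have hef : ⟪e, f⟫_ℝ = 0 := Submodule.mem_orthogonal_singleton_iff_inner_right.1 (b 0).2
  have heg : ⟪e, g⟫_ℝ = 0 := Submodule.mem_orthogonal_singleton_iff_inner_right.1 (b 1).2
  have hff : ⟪f, f⟫_ℝ = 1 := by
    have := b.orthonormal.1 0
    rw [real_inner_self_eq_norm_sq, hf, Submodule.norm_coe, this, one_pow]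
  have hgg : ⟪g, g⟫_ℝ = 1 := by
    have := b.orthonormal.1 1
    rw [real_inner_self_eq_norm_sq, hg, Submodule.norm_coe, this, one_pow]
  have hfg : ⟪f, g⟫_ℝ = 0 := b.orthonormal.2 (i := 0) (j := 1) (by decide)
  have hee : ⟪e, e⟫_ℝ = D ^ 2 := real_inner_self_eq_norm_sq e
  obtain ⟨hl, hr⟩ := abs_lt.1 hlow
  set a : ℝ := (d₁ ^ 2 + D ^ 2 - d₂ ^ 2) / (2 * D ^ 2) with ha
  have haD : 2 * a * D ^ 2 = d₁ ^ 2 + D ^ 2 - d₂ ^ 2 := by rw [ha]; field_simp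
  have hpos : 0 < d₁ ^ 2 - a ^ 2 * D ^ 2 := by
    have h : 0 < ((d₁ + d₂ - D) * (d₂ - d₁ + D)) * ((D + d₁ - d₂) * (D + d₁ + d₂)) := by
      apply mul_pos <;> apply mul_pos <;> linarith
    have : d₁ ^ 2 - a ^ 2 * D ^ 2 =
        ((d₁ + d₂ - D) * (d₂ - d₁ + D)) * ((D + d₁ - d₂) * (D + d₁ + d₂)) / (4 * D ^ 2) := by
      rw [ha]; field_simp; ring
    rw [this]; positivity
  set ρ := √(d₁ ^ 2 - a ^ 2 * D ^ 2) with hρ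
  have hρ0 : 0 < ρ := Real.sqrt_pos.2 hpos
  have hρ2 : ρ ^ 2 = d₁ ^ 2 - a ^ 2 * D ^ 2 := Real.sq_sqrt hpos.le
  have key (c s : ℝ) :
      ‖c • e + (ρ * s) • f + (ρ * √(1 - s ^ 2)) • g‖ ^ 2 =
        c ^ 2 * D ^ 2 + ρ ^ 2 * (s ^ 2 + √(1 - s ^ 2) ^ 2) := by
    rw [← real_inner_self_eq_norm_sq]
    simp only [inner_add_left, inner_add_right, real_inner_smul_left, real_inner_smul_right,
      real_inner_comm e f, real_inner_comm e g, real_inner_comm f g, hef, heg, hfg, hff, hgg, hee]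
    ring
  refine Set.infinite_of_injOn_mapsTo
    (f := fun s : ℝ => Z₁ + (a • e + (ρ * s) • f + (ρ * √(1 - s ^ 2)) • g))
    (fun s _ t _ hst => ?_) (fun s hs => ?_) (Set.Icc_infinite (zero_lt_one (α := ℝ)))
  · have h := congrArg (fun v => ⟪v, f⟫_ℝ) (add_left_cancel hst)
    simp only [inner_add_left, real_inner_smul_left, hef, hff, real_inner_comm f g, hfg] at h
    have : ρ * s = ρ * t := by linarith
    exact mul_left_cancel₀ hρ0.ne' this
  · have hs1 : 0 ≤ 1 - s ^ 2 := by nlinarith [hs.1, hs.2]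
    refine ⟨?_, ?_⟩
    · refine (sq_eq_sq₀ (norm_nonneg _) hd₁).1 ?_
      rw [add_sub_cancel_left, key, Real.sq_sqrt hs1]
      linarith
    · refine (sq_eq_sq₀ (norm_nonneg _) hd₂).1 ?_
      have : Z₁ + (a • e + (ρ * s) • f + (ρ * √(1 - s ^ 2)) • g) - Z₂ =
          (a - 1) • e + (ρ * s) • f + (ρ * √(1 - s ^ 2)) • g := by
        rw [he]; module
      rw [this, key, Real.sq_sqrt hs1]
      linarith

end

/-- Two measurements, distance error, three dimensions: the solution set `X` has
exactly one element iff `‖Z₂ - Z₁‖ = d₁ + d₂` or `‖Z₂ - Z₁‖ = d₁ - d₂`; otherwise `X`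
is infinite. -/
theorem two_meas_distance_error_count_3D
    (Z₁ Z₂ : EuclideanSpace ℝ (Fin 3)) (hZ : Z₁ ≠ Z₂)
    (d₁ d₂ : ℝ) (hd₂ : 0 ≤ d₂) (hd : d₂ ≤ d₁)
    (O : EuclideanSpace ℝ (Fin 3) → ℝ)
    (hO : ∀ W, O W = |‖W - Z₁‖ - d₁| + |‖W - Z₂‖ - d₂|)
    (X : Set (EuclideanSpace ℝ (Fin 3)))
    (hX : X = {W | ∀ V, O W ≤ O V}) :
    (X.encard = 1 ↔ (‖Z₂ - Z₁‖ = d₁ + d₂ ∨ ‖Z₂ - Z₁‖ = d₁ - d₂)) ∧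
    (¬(‖Z₂ - Z₁‖ = d₁ + d₂ ∨ ‖Z₂ - Z₁‖ = d₁ - d₂) → X.Infinite) := by
  have hD : 0 < ‖Z₂ - Z₁‖ := norm_pos_iff.2 (sub_ne_zero.2 hZ.symm)
  have hd₁ : 0 ≤ d₁ := hd₂.trans hd
  have hO0 (V) : 0 ≤ O V := by rw [hO]; positivity
  have hunique (h : ‖Z₂ - Z₁‖ = d₁ + d₂ ∨ ‖Z₂ - Z₁‖ = d₁ - d₂) : X.encard = 1 := by
    have hp : O (AffineMap.lineMap Z₁ Z₂ (d₁ / ‖Z₂ - Z₁‖)) = 0 := by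
      rw [hO, norm_lineMap_sub_left hZ hd₁, norm_lineMap_sub_right hZ]
      have : |d₁ - ‖Z₂ - Z₁‖| = d₂ := by
        rcases h with h | h <;> rw [h] <;> simp [abs_of_nonneg hd₂]
      simp [this]
    refine Set.encard_eq_one.2 ⟨AffineMap.lineMap Z₁ Z₂ (d₁ / ‖Z₂ - Z₁‖), ?_⟩
    rw [hX, Set.eq_singleton_iff_unique_mem]
    refine ⟨fun V => hp ▸ hO0 V, fun W hW => ?_⟩
    have hW0 := hW (AffineMap.lineMap Z₁ Z₂ (d₁ / ‖Z₂ - Z₁‖))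
    rw [hp, hO] at hW0
    have i₁ := abs_nonneg (‖W - Z₁‖ - d₁)
    have i₂ := abs_nonneg (‖W - Z₂‖ - d₂)
    exact eq_lineMap_of_tangent hZ h
      (sub_eq_zero.1 (abs_eq_zero.1 (by linarith)))
      (sub_eq_zero.1 (abs_eq_zero.1 (by linarith)))
  have hinf (h : ¬(‖Z₂ - Z₁‖ = d₁ + d₂ ∨ ‖Z₂ - Z₁‖ = d₁ - d₂)) : X.Infinite := by
    push Not at h
    have htri (V : EuclideanSpace ℝ (Fin 3)) :
        ‖Z₂ - Z₁‖ ≤ ‖V - Z₁‖ + ‖V - Z₂‖ ∧ ‖V - Z₁‖ ≤ ‖V - Z₂‖ + ‖Z₂ - Z₁‖ := by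
      constructor
      · rw [norm_sub_rev V Z₂, add_comm]
        exact norm_sub_le_norm_sub_add_norm_sub _ _ _
      · exact norm_sub_le_norm_sub_add_norm_sub _ _ _
    rcases lt_or_gt_of_ne h.1 with hup | hfar
    · rcases lt_or_gt_of_ne h.2 with hnear | hlow
      · refine infinite_of_lineMap_mem hZ (a := d₂ + ‖Z₂ - Z₁‖) (b := d₁) (by linarith) ?_
        rintro t ⟨h₁, h₂⟩
        rw [hX]
        intro V
        obtain ⟨-, hV⟩ := htri V
        rw [hO, hO, norm_lineMap_sub_left hZ (by linarith), norm_lineMap_sub_right hZ,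
          abs_of_nonneg (show 0 ≤ t - ‖Z₂ - Z₁‖ by linarith),
          abs_of_nonpos (show t - d₁ ≤ 0 by linarith),
          abs_of_nonneg (show 0 ≤ t - ‖Z₂ - Z₁‖ - d₂ by linarith)]
        linarith [neg_abs_le (‖V - Z₁‖ - d₁), le_abs_self (‖V - Z₂‖ - d₂)]
      · refine (infinite_sphere_inter_sphere finrank_euclideanSpace_fin hZ hd₁ hd₂
          (by rwa [abs_of_nonneg (by linarith)]) hup).mono ?_
        rintro W ⟨h₁, h₂⟩
        rw [hX]
        intro V
        have : O W = 0 := by simp [hO, h₁, h₂]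
        exact this ▸ hO0 V
    · refine infinite_of_lineMap_mem hZ (a := d₁) (b := ‖Z₂ - Z₁‖ - d₂) (by linarith) ?_
      rintro t ⟨h₁, h₂⟩
      rw [hX]
      intro V
      obtain ⟨hV, -⟩ := htri V
      rw [hO, hO, norm_lineMap_sub_left hZ (by linarith), norm_lineMap_sub_right hZ,
        abs_of_nonpos (show t - ‖Z₂ - Z₁‖ ≤ 0 by linarith),
        abs_of_nonneg (show 0 ≤ t - d₁ by linarith),
        abs_of_nonneg (show 0 ≤ -(t - ‖Z₂ - Z₁‖) - d₂ by linarith)]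
      linarith [le_abs_self (‖V - Z₁‖ - d₁), le_abs_self (‖V - Z₂‖ - d₂)]
  refine ⟨⟨fun h => ?_, hunique⟩, hinf⟩
  by_contra hne
  have := hinf hne
  rw [← Set.encard_eq_top_iff, h] at this
  exact ENat.one_ne_top this
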